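/- Let S be a system of m GF(2)-equations with distinct left-hand-side index sets I_1,...,I_m ⊆ {1,...,n} (nonempty) and weights w_j, and suppose every variable index appears in at most ρ ≥ 2 of the sets I_j. With X = Σ_j (−1)^{b_j} w_j Π_{i∈I_j} ε_i for independent uniform ±1 variables ε_i, we have E(X^4) ≤ 2ρ^2 (E(X^2))^2. -/

import Mathlib

open Finset

/-- The Walsh character `σ ↦ ∏ i ∈ A, ε_i`, where `ε_i = 1` if `σ i` and `-1` otherwise. -/
def walsh {ι : Type*} (A : Finset ι) (σ : ι → Bool) : ℝ :=
  ∏ i ∈ A, (if σ i then (1 : ℝ) else -1)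

theorem walsh_mul {ι : Type*} [DecidableEq ι] (A B : Finset ι) (σ : ι → Bool) :
    walsh A σ * walsh B σ = walsh (symmDiff A B) σ := by
  have hsq : walsh (A ∩ B) σ * walsh (A ∩ B) σ = 1 := by
    rw [walsh, ← prod_mul_distrib]
    exact prod_eq_one fun i _ => by split_ifs <;> norm_num
  have hA : walsh A σ = walsh (A ∩ B) σ * walsh (A \ B) σ :=
    (prod_inter_mul_prod_sdiff A B _).symm
  have hB : walsh B σ = walsh (A ∩ B) σ * walsh (B \ A) σ := by
    rw [inter_comm]
    exact (prod_inter_mul_prod_sdiff B A _).symm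
  have hD : walsh (symmDiff A B) σ = walsh (A \ B) σ * walsh (B \ A) σ :=
    prod_union disjoint_sdiff_sdiff
  rw [hA, hB, hD]
  linear_combination (walsh (A \ B) σ * walsh (B \ A) σ) * hsq

theorem sum_walsh {ι : Type*} [Fintype ι] [DecidableEq ι] (A : Finset ι) :
    ∑ σ : ι → Bool, walsh A σ = if A = ∅ then (2 : ℝ) ^ Fintype.card ι else 0 := by
  have h : ∀ σ : ι → Bool,
      walsh A σ = ∏ i, (if i ∈ A then (if σ i then (1 : ℝ) else -1) else 1) := by
    intro σ
    rw [walsh, prod_ite_mem, univ_inter]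
  simp_rw [h]
  rw [← Fintype.prod_sum (fun i (c : Bool) => if i ∈ A then (if c then (1 : ℝ) else -1) else 1)]
  split_ifs with hA
  · subst hA
    norm_num
  · obtain ⟨i, hi⟩ := nonempty_iff_ne_empty.mpr hA
    exact prod_eq_zero (mem_univ i) (by simp [hi])

theorem sum_sq_walsh_expansion {ι : Type*} [Fintype ι] [DecidableEq ι] (g : Finset ι → ℝ) :
    ∑ σ : ι → Bool, (∑ D, g D * walsh D σ) ^ 2 = 2 ^ Fintype.card ι * ∑ D, g D ^ 2 := by
  have h : ∀ σ : ι → Bool, (∑ D, g D * walsh D σ) ^ 2 =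
      ∑ D, ∑ E, g D * g E * walsh (symmDiff D E) σ := by
    intro σ
    rw [sq, sum_mul_sum]
    refine sum_congr rfl fun D _ => sum_congr rfl fun E _ => ?_
    rw [← walsh_mul]
    ring
  simp_rw [h]
  rw [sum_comm, mul_sum]
  refine sum_congr rfl fun D _ => ?_
  rw [sum_comm]
  simp_rw [← mul_sum, sum_walsh, ← bot_eq_empty, symmDiff_eq_bot]
  simp
  ring

/-- The coefficient of `walsh D` in the square of `∑ j, a j * walsh (I j)`. -/
def sqCoeff {ι κ : Type*} [DecidableEq ι] [Fintype κ]
    (I : κ → Finset ι) (a : κ → ℝ) (D : Finset ι) : ℝ :=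
  ∑ p : κ × κ with symmDiff (I p.1) (I p.2) = D, a p.1 * a p.2

theorem sq_sum_mul_walsh {ι κ : Type*} [Fintype ι] [DecidableEq ι] [Fintype κ]
    (I : κ → Finset ι) (a : κ → ℝ) (σ : ι → Bool) :
    (∑ j, a j * walsh (I j) σ) ^ 2 = ∑ D, sqCoeff I a D * walsh D σ := by
  have h : ∀ D, sqCoeff I a D * walsh D σ =
      ∑ p : κ × κ with symmDiff (I p.1) (I p.2) = D,
        a p.1 * walsh (I p.1) σ * (a p.2 * walsh (I p.2) σ) := by
    intro D
    rw [sqCoeff, sum_mul]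
    refine sum_congr rfl fun p hp => ?_
    rw [← (mem_filter.mp hp).2, ← walsh_mul]
    ring
  simp_rw [h]
  rw [sum_fiberwise, sq, sum_mul_sum, ← Fintype.sum_prod_type']

theorem sqCoeff_empty {ι κ : Type*} [DecidableEq ι] [Fintype κ] [DecidableEq κ]
    {I : κ → Finset ι} (hI : Function.Injective I) (a : κ → ℝ) :
    sqCoeff I a ∅ = ∑ j, a j ^ 2 := by
  simp_rw [sqCoeff, ← bot_eq_empty, symmDiff_eq_bot, hI.eq_iff]
  rw [sum_filter, Fintype.sum_prod_type]
  simp [sq]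

theorem card_symmDiff_eq_le {ι κ : Type*} [DecidableEq ι] [Fintype κ] [DecidableEq κ]
    {I : κ → Finset ι} (hI : Function.Injective I) {ρ : ℕ}
    (hocc : ∀ i, #{j | i ∈ I j} ≤ ρ) {D : Finset ι} (hD : D.Nonempty) :
    #{p : κ × κ | symmDiff (I p.1) (I p.2) = D} ≤ 2 * ρ := by
  obtain ⟨i, hi⟩ := hD
  have hsub : ({p : κ × κ | symmDiff (I p.1) (I p.2) = D} : Finset (κ × κ)) ⊆
      ({p : κ × κ | symmDiff (I p.1) (I p.2) = D ∧ i ∈ I p.1} : Finset (κ × κ)) ∪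
      ({p : κ × κ | symmDiff (I p.1) (I p.2) = D ∧ i ∈ I p.2} : Finset (κ × κ)) := by
    intro p hp
    have hp' : symmDiff (I p.1) (I p.2) = D := (mem_filter.mp hp).2
    have hip := hi
    rw [← hp', mem_symmDiff] at hip
    simp only [mem_union, mem_filter, mem_univ, true_and]
    tauto
  have hfst : #{p : κ × κ | symmDiff (I p.1) (I p.2) = D ∧ i ∈ I p.1} ≤ ρ := by
    refine (card_le_card_of_injOn Prod.fst (fun p hp => ?_) fun p hp q hq hpq => ?_).trans (hocc i)
    · simp at hp ⊢
      exact hp.2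
    · simp at hp hq
      refine Prod.ext hpq (hI (symmDiff_right_injective (I p.1) ?_))
      change symmDiff (I p.1) (I p.2) = symmDiff (I p.1) (I q.2)
      rw [hp.1, hpq, hq.1]
  have hsnd : #{p : κ × κ | symmDiff (I p.1) (I p.2) = D ∧ i ∈ I p.2} ≤ ρ := by
    refine (card_le_card_of_injOn Prod.snd (fun p hp => ?_) fun p hp q hq hpq => ?_).trans (hocc i)
    · simp at hp ⊢
      exact hp.2
    · simp at hp hq
      refine Prod.ext (hI (symmDiff_left_injective (I p.2) ?_)) hpq
      change symmDiff (I p.1) (I p.2) = symmDiff (I q.1) (I p.2)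
      rw [hp.1, hpq, hq.1]
  have := (card_le_card hsub).trans (card_union_le _ _)
  omega

theorem sum_sqCoeff_sq_le {ι κ : Type*} [Fintype ι] [DecidableEq ι] [Fintype κ] [DecidableEq κ]
    {I : κ → Finset ι} (hI : Function.Injective I) (a : κ → ℝ) {ρ : ℕ}
    (hocc : ∀ i, #{j | i ∈ I j} ≤ ρ) :
    ∑ D, sqCoeff I a D ^ 2 ≤ (2 * ρ + 1) * (∑ j, a j ^ 2) ^ 2 := by
  have hle : ∀ D, sqCoeff I a D ^ 2 ≤ (if D = ∅ then (∑ j, a j ^ 2) ^ 2 else 0) +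
      2 * ρ * ∑ p : κ × κ with symmDiff (I p.1) (I p.2) = D, (a p.1 * a p.2) ^ 2 := by
    intro D
    have hnonneg : 0 ≤ ∑ p : κ × κ with symmDiff (I p.1) (I p.2) = D, (a p.1 * a p.2) ^ 2 :=
      sum_nonneg fun _ _ => sq_nonneg _
    rcases D.eq_empty_or_nonempty with rfl | hD
    · rw [if_pos rfl, sqCoeff_empty hI]
      have : (0 : ℝ) ≤ 2 * ρ := by positivity
      exact le_add_of_nonneg_right (mul_nonneg this hnonneg)
    · rw [if_neg hD.ne_empty, zero_add]
      refine sq_sum_le_card_mul_sum_sq.trans (mul_le_mul_of_nonneg_right ?_ hnonneg)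
      exact_mod_cast card_symmDiff_eq_le hI hocc hD
  refine (sum_le_sum fun D _ => hle D).trans_eq ?_
  rw [sum_add_distrib, ← mul_sum, sum_fiberwise, Fintype.sum_prod_type]
  simp_rw [mul_pow, ← sum_mul_sum]
  simp
  ring

/- For a reduced GF(2) system (nonempty, pairwise distinct index sets) in which
every variable occurs in at most `ρ ≥ 2` equations, the random variable
`X = Σ_j (−1)^{b_j} w_j Π_{i∈I_j} ε_i` satisfies `E(X⁴) ≤ 2ρ²(E(X²))²`. -/
theorem stmt_10 (n m : ℕ) (I : Fin m → Finset (Fin n)) (b : Fin m → Bool)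
    (w : Fin m → ℝ) (hI : ∀ j, (I j).Nonempty) (hw : ∀ j, 0 < w j)
    (hdist : Function.Injective I)
    (ρ : ℕ) (hρ : 2 ≤ ρ)
    (hocc : ∀ i : Fin n, (univ.filter (fun j => i ∈ I j)).card ≤ ρ)
    (X : (Fin n → Bool) → ℝ)
    (hX : ∀ σ, X σ = ∑ j, (if b j then (-1 : ℝ) else 1) * w j *
                        ∏ i ∈ I j, (if σ i then (1 : ℝ) else -1)) :
    (∑ σ : Fin n → Bool, X σ ^ 4) / (2 ^ n : ℝ) ≤
      2 * ρ ^ 2 * ((∑ σ : Fin n → Bool, X σ ^ 2) / (2 ^ n : ℝ)) ^ 2 := by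
  set a : Fin m → ℝ := fun j => (if b j then (-1 : ℝ) else 1) * w j
  have hsq : ∀ σ, X σ ^ 2 = ∑ D, sqCoeff I a D * walsh D σ := fun σ => by
    rw [hX, ← sq_sum_mul_walsh]
    rfl
  have h2 : (∑ σ, X σ ^ 2) / (2 ^ n : ℝ) = ∑ j, a j ^ 2 := by
    simp_rw [hsq]
    rw [sum_comm]
    simp_rw [← mul_sum, sum_walsh]
    simp [sqCoeff_empty hdist]
  have h4 : (∑ σ, X σ ^ 4) / (2 ^ n : ℝ) = ∑ D, sqCoeff I a D ^ 2 := by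
    have hpow : ∀ σ, X σ ^ 4 = (∑ D, sqCoeff I a D * walsh D σ) ^ 2 := fun σ => by
      rw [← hsq]
      ring
    simp_rw [hpow]
    rw [sum_sq_walsh_expansion, Fintype.card_fin]
    field_simp
  rw [h2, h4]
  refine (sum_sqCoeff_sq_le hdist a hocc).trans (mul_le_mul_of_nonneg_right ?_ (sq_nonneg _))
  have hρ' : (2 : ℝ) ≤ ρ := by exact_mod_cast hρ
  nlinarith
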